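/- There exist ε₀ > 0, ρ > 0, c > 0, M ≥ 1 and μ ∈ (0,1), depending only on N, Λ, α, β, such that the following holds: if u is a bounded Borel measurable function on ℝ^N satisfying L_ε^- u ≤ ρ in Q_{10√N} and u ≥ 0 in ℝ^N, for some 0 < ε ≤ ε₀, and inf_{Q_3} u ≤ 1, then |{u > K^k} ∩ Q_1| ≤ c/((1−μ)K) + μ^k for every K ≥ M and every k ∈ ℕ. -/

import Mathlib

open MeasureTheory Metric

/-- The second-order difference `δu(x,y) = u(x+y) + u(x−y) − 2u(x)`. -/
noncomputable def ddiff {N : ℕ} (u : EuclideanSpace ℝ (Fin N) → ℝ)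
    (x y : EuclideanSpace ℝ (Fin N)) : ℝ :=
  u (x + y) + u (x - y) - 2 * u x

/-- The minimal Pucci-type operator
`L_ε^- u(x) = (1/(2ε²))(α·inf_{z ∈ B_Λ} δu(x,εz) + β·⨍_{B_1} δu(x,εy) dy)`. -/
noncomputable def Lminus {N : ℕ} (Λ α β ε : ℝ) (u : EuclideanSpace ℝ (Fin N) → ℝ)
    (x : EuclideanSpace ℝ (Fin N)) : ℝ :=
  (1 / (2 * ε ^ 2)) *
    (α * sInf ((fun z => ddiff u x (ε • z)) '' ball (0 : EuclideanSpace ℝ (Fin N)) Λ)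
      + β * ⨍ y in ball (0 : EuclideanSpace ℝ (Fin N)) 1, ddiff u x (ε • y))

/-- The open axis-parallel cube with center having coordinates `c : Fin N → ℝ` and side
length `r`. -/
def cube {N : ℕ} (c : Fin N → ℝ) (r : ℝ) : Set (EuclideanSpace ℝ (Fin N)) :=
  {y | ∀ i, |y i - c i| < r / 2}

section

variable {N : ℕ} {Λ α β ε ρ : ℝ} {u : EuclideanSpace ℝ (Fin N) → ℝ}

/-- `u` satisfies `L_ε^- u ≤ ρ` at `x`, with the infimum replaced by arbitrary lower bounds. -/
def SuperAt (Λ α β ε ρ : ℝ) (u : EuclideanSpace ℝ (Fin N) → ℝ)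
    (x : EuclideanSpace ℝ (Fin N)) : Prop :=
  ∀ m, (∀ z ∈ ball (0 : EuclideanSpace ℝ (Fin N)) Λ, m ≤ ddiff u x (ε • z)) →
    α * m + β * (⨍ y in ball (0 : EuclideanSpace ℝ (Fin N)) 1, ddiff u x (ε • y)) ≤ 2 * ε ^ 2 * ρ

lemma superAt_of_Lminus_le {x : EuclideanSpace ℝ (Fin N)} (hΛ : 0 < Λ) (hα : 0 ≤ α) (hε : 0 < ε)
    (h : Lminus Λ α β ε u x ≤ ρ) : SuperAt Λ α β ε ρ u x := by
  intro m hm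
  have hs : m ≤ sInf ((fun z => ddiff u x (ε • z)) '' ball (0 : EuclideanSpace ℝ (Fin N)) Λ) := by
    apply le_csInf ((nonempty_ball.2 hΛ).image _)
    rintro _ ⟨z, hz, rfl⟩
    exact hm z hz
  have h2 := mul_le_mul_of_nonneg_left hs hα
  unfold Lminus at h
  have h3 : (0 : ℝ) < 2 * ε ^ 2 := by positivity
  rw [one_div, inv_mul_le_iff₀ h3] at h
  linarith

lemma SuperAt.mono {ρ' : ℝ} {x : EuclideanSpace ℝ (Fin N)} (h : SuperAt Λ α β ε ρ u x)
    (hρ : ρ ≤ ρ') : SuperAt Λ α β ε ρ' u x := by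
  intro m hm
  refine (h m hm).trans ?_
  gcongr

lemma SuperAt.rescale {c x : EuclideanSpace ℝ (Fin N)} {r t : ℝ} (hr : 0 < r) (ht : 0 < t)
    (h : SuperAt Λ α β ε ρ u (c + r • x)) :
    SuperAt Λ α β (ε / r) (r ^ 2 / t * ρ) (fun y => u (c + r • y) / t) x := by
  have key : ∀ z, ddiff (fun y => u (c + r • y) / t) x ((ε / r) • z)
      = t⁻¹ * ddiff u (c + r • x) (ε • z) := by
    intro z
    have h1 : c + r • (x + (ε / r) • z) = c + r • x + ε • z := by
      rw [smul_add, smul_smul, mul_div_cancel₀ _ hr.ne', add_assoc]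
    have h2 : c + r • (x - (ε / r) • z) = c + r • x - ε • z := by
      rw [smul_sub, smul_smul, mul_div_cancel₀ _ hr.ne', add_sub_assoc]
    simp only [ddiff, h1, h2]
    ring
  intro m hm
  have h1 := h (t * m) (fun z hz => by
    have := hm z hz
    rw [key, ← div_eq_inv_mul, le_div_iff₀ ht] at this
    linarith)
  simp only [key]
  have h2 : (⨍ y in ball (0 : EuclideanSpace ℝ (Fin N)) 1, t⁻¹ * ddiff u (c + r • x) (ε • y))
      = t⁻¹ * ⨍ y in ball (0 : EuclideanSpace ℝ (Fin N)) 1, ddiff u (c + r • x) (ε • y) := by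
    rw [setAverage_eq, setAverage_eq, integral_const_mul]
    simp only [smul_eq_mul]
    ring
  rw [h2]
  calc _ = t⁻¹ * (α * (t * m) + β * ⨍ y in ball (0 : EuclideanSpace ℝ (Fin N)) 1,
            ddiff u (c + r • x) (ε • y)) := by field_simp
    _ ≤ t⁻¹ * (2 * ε ^ 2 * ρ) := by gcongr
    _ = _ := by field_simp

/-- The half-open cube with lower corner `a` and side length `r`. -/
def hcube (a : Fin N → ℝ) (r : ℝ) : Set (EuclideanSpace ℝ (Fin N)) :=
  {y | ∀ i, a i ≤ y i ∧ y i < a i + r}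

lemma hcube_eq_preimage (a : Fin N → ℝ) (r : ℝ) :
    hcube a r = (MeasurableEquiv.toLp 2 (Fin N → ℝ)).symm ⁻¹'
      (Set.univ.pi fun i => Set.Ico (a i) (a i + r)) := by
  ext y
  simp [hcube]

lemma measurableSet_hcube (a : Fin N → ℝ) (r : ℝ) : MeasurableSet (hcube a r) := by
  rw [hcube_eq_preimage]
  exact (MeasurableEquiv.measurable _) (MeasurableSet.univ_pi fun i => measurableSet_Ico)

lemma volume_hcube (a : Fin N → ℝ) {r : ℝ} (hr : 0 ≤ r) :
    volume (hcube a r) = ENNReal.ofReal (r ^ N) := by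
  rw [hcube_eq_preimage,
    (EuclideanSpace.volume_preserving_symm_measurableEquiv_toLp (Fin N)).measure_preimage
      (MeasurableSet.univ_pi fun i => measurableSet_Ico).nullMeasurableSet, Real.volume_pi_Ico]
  simp [ENNReal.ofReal_pow hr]

lemma norm_le_sqrt_mul {x : EuclideanSpace ℝ (Fin N)} {b : ℝ} (hb : 0 ≤ b)
    (h : ∀ i, |x i| ≤ b) : ‖x‖ ≤ √N * b := by
  rw [EuclideanSpace.norm_eq]
  apply Real.sqrt_le_iff.2 ⟨by positivity, ?_⟩
  calc ∑ i, ‖x i‖ ^ 2 ≤ ∑ _i : Fin N, b ^ 2 := by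
        gcongr with i
        exact h i
    _ = (√N * b) ^ 2 := by
        rw [mul_pow, Real.sq_sqrt (Nat.cast_nonneg _)]
        simp

lemma abs_apply_le_norm (x : EuclideanSpace ℝ (Fin N)) (i : Fin N) : |x i| ≤ ‖x‖ :=
  PiLp.norm_apply_le x i

lemma volume_eq_rescale (c : EuclideanSpace ℝ (Fin N)) {r : ℝ} (hr : 0 < r)
    (S : Set (EuclideanSpace ℝ (Fin N))) :
    volume S = ENNReal.ofReal (r ^ N) * volume ((fun y => c + r • y) ⁻¹' S) := by
  have h : (fun y => c + r • y) ⁻¹' S = (fun y => r • y) ⁻¹' ((fun y => c + y) ⁻¹' S) := rfl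
  rw [h, Measure.addHaar_preimage_smul _ hr.ne', measure_preimage_add, ← mul_assoc,
    ← ENNReal.ofReal_mul (by positivity)]
  simp only [finrank_euclideanSpace, Fintype.card_fin]
  rw [abs_of_pos (by positivity), mul_inv_cancel₀ (by positivity)]
  simp

/-- A ball of radius `1/4` inside the unit ball and inside the cap in direction `e`. -/
lemma exists_ball_subset_cap (e : EuclideanSpace ℝ (Fin N)) :
    ∃ y₀, ∀ y ∈ ball y₀ (1 / 4), y ∈ ball (0 : EuclideanSpace ℝ (Fin N)) 1 ∧
      ‖e‖ / 4 ≤ inner ℝ e y := by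
  by_cases he : e = 0
  · refine ⟨0, fun y hy => ⟨ball_subset_ball (by norm_num) hy, by simp [he]⟩⟩
  · have hn : 0 < ‖e‖ := norm_pos_iff.2 he
    refine ⟨(2 * ‖e‖)⁻¹ • e, fun y hy => ?_⟩
    have hy0 : ‖(2 * ‖e‖)⁻¹ • e‖ = 1 / 2 := by
      rw [norm_smul, norm_inv, norm_mul, norm_norm]
      simp only [Real.norm_ofNat]
      field_simp
    rw [mem_ball, dist_eq_norm] at hy
    constructor
    · rw [mem_ball_zero_iff]
      have := norm_add_le (y - (2 * ‖e‖)⁻¹ • e) ((2 * ‖e‖)⁻¹ • e)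
      rw [sub_add_cancel] at this
      linarith
    · have h1 : inner ℝ e y = inner ℝ e (y - (2 * ‖e‖)⁻¹ • e) + ‖e‖ / 2 := by
        rw [inner_sub_right, inner_smul_right, real_inner_self_eq_norm_sq]
        field_simp
        ring
      have h2 := abs_real_inner_le_norm e (y - (2 * ‖e‖)⁻¹ • e)
      have h3 := (abs_le.1 h2).1
      nlinarith

lemma le_average_of_le_cap (hN : 1 ≤ N) {f : EuclideanSpace ℝ (Fin N) → ℝ}
    (hf : IntegrableOn f (ball 0 1)) (e : EuclideanSpace ℝ (Fin N)) {a b : ℝ}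
    (hb : ∀ y ∈ ball (0 : EuclideanSpace ℝ (Fin N)) 1, b ≤ f y)
    (hab : ∀ y ∈ ball (0 : EuclideanSpace ℝ (Fin N)) 1, ‖e‖ / 4 ≤ inner ℝ e y → b + a ≤ f y) :
    b + (1 / 4) ^ N * a ≤ ⨍ y in ball (0 : EuclideanSpace ℝ (Fin N)) 1, f y := by
  have : Nonempty (Fin N) := ⟨⟨0, hN⟩⟩
  obtain ⟨y₀, hy₀⟩ := exists_ball_subset_cap e
  have hsub : ball y₀ (1 / 4) ⊆ ball (0 : EuclideanSpace ℝ (Fin N)) 1 := fun y hy => (hy₀ y hy).1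
  have hpos : 0 < volume.real (ball (0 : EuclideanSpace ℝ (Fin N)) 1) :=
    ENNReal.toReal_pos (measure_ball_pos _ _ one_pos).ne' measure_ball_lt_top.ne
  have hvol : volume.real (ball y₀ (1 / 4))
      = (1 / 4) ^ N * volume.real (ball (0 : EuclideanSpace ℝ (Fin N)) 1) := by
    rw [Measure.real, Measure.addHaar_ball _ _ (by norm_num), ENNReal.toReal_mul,
      ENNReal.toReal_ofReal (by positivity), finrank_euclideanSpace, Fintype.card_fin]
    rfl
  have hconst : Integrable (fun _ => b)
      (volume.restrict (ball (0 : EuclideanSpace ℝ (Fin N)) 1)) :=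
    integrableOn_const measure_ball_lt_top.ne
  have hind : Integrable ((ball y₀ (1 / 4)).indicator fun _ => a)
      (volume.restrict (ball (0 : EuclideanSpace ℝ (Fin N)) 1)) :=
    IntegrableOn.indicator (integrableOn_const measure_ball_lt_top.ne) measurableSet_ball
  rw [setAverage_eq, smul_eq_mul, le_inv_mul_iff₀ hpos]
  calc volume.real (ball (0 : EuclideanSpace ℝ (Fin N)) 1) * (b + (1 / 4) ^ N * a)
      = ∫ y in ball (0 : EuclideanSpace ℝ (Fin N)) 1,
          (b + (ball y₀ (1 / 4)).indicator (fun _ => a) y) := by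
        rw [integral_add hconst hind, setIntegral_indicator measurableSet_ball,
          Set.inter_eq_self_of_subset_right hsub]
        simp only [setIntegral_const, smul_eq_mul, hvol]
        ring
    _ ≤ ∫ y in ball (0 : EuclideanSpace ℝ (Fin N)) 1, f y := by
        refine setIntegral_mono_on ?_ hf measurableSet_ball fun y hy => ?_
        · exact hconst.add hind
        · by_cases h : y ∈ ball y₀ (1 / 4)
          · rw [Set.indicator_of_mem h]
            exact hab y hy (hy₀ y h).2
          · rw [Set.indicator_of_notMem h, add_zero]
            exact hb y hy

lemma integrableOn_ddiff (hu : Measurable u) (hb : ∃ K, ∀ x, |u x| ≤ K)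
    (x : EuclideanSpace ℝ (Fin N)) (ε : ℝ) :
    IntegrableOn (fun y => ddiff u x (ε • y)) (ball 0 1) := by
  obtain ⟨K, hK⟩ := hb
  refine Measure.integrableOn_of_bounded (M := 4 * K) measure_ball_lt_top.ne ?_ ?_
  · unfold ddiff
    exact Measurable.aestronglyMeasurable (by fun_prop)
  · refine Filter.Eventually.of_forall fun y => ?_
    have h1 := abs_le.1 (hK (x + ε • y))
    have h2 := abs_le.1 (hK (x - ε • y))
    have h3 := abs_le.1 (hK x)
    rw [Real.norm_eq_abs, abs_le, ddiff]
    constructor <;> linarith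

lemma SuperAt.lintegral_ball_le (hN : 1 ≤ N) (hu : Measurable u) (hb : ∃ K, ∀ x, |u x| ≤ K)
    (h0 : ∀ x, 0 ≤ u x) (hε : 0 < ε) (hα : 0 ≤ α) (hβ : 0 < β) (hαβ : α + β = 1)
    {x : EuclideanSpace ℝ (Fin N)} (h : SuperAt Λ α β ε ρ u x) :
    ∫⁻ y in ball x ε, ENNReal.ofReal (u y) ≤
      ENNReal.ofReal (2 * (ε ^ 2 * ρ + u x) / β) * volume (ball x ε) := by
  have : Nonempty (Fin N) := ⟨⟨0, hN⟩⟩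
  have hpos : 0 < volume.real (ball (0 : EuclideanSpace ℝ (Fin N)) 1) :=
    ENNReal.toReal_pos (measure_ball_pos _ _ one_pos).ne' measure_ball_lt_top.ne
  have hint : IntegrableOn (fun y => u (x + ε • y)) (ball 0 1) := by
    obtain ⟨K, hK⟩ := hb
    exact Measure.integrableOn_of_bounded (M := K) measure_ball_lt_top.ne
      (Measurable.aestronglyMeasurable (by fun_prop)) (Filter.Eventually.of_forall fun y => hK _)
  have h1 := h (-2 * u x) (fun z _ => by
    have := h0 (x + ε • z)
    have := h0 (x - ε • z)
    unfold ddiff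
    linarith)
  have h2 : (∫ y in ball (0 : EuclideanSpace ℝ (Fin N)) 1, u (x + ε • y))
      - volume.real (ball (0 : EuclideanSpace ℝ (Fin N)) 1) * (2 * u x)
      ≤ ∫ y in ball (0 : EuclideanSpace ℝ (Fin N)) 1, ddiff u x (ε • y) := by
    have : volume.real (ball (0 : EuclideanSpace ℝ (Fin N)) 1) * (2 * u x)
        = ∫ y in ball (0 : EuclideanSpace ℝ (Fin N)) 1, (2 * u x) := by simp
    rw [this, ← integral_sub hint (integrableOn_const measure_ball_lt_top.ne)]
    refine setIntegral_mono_on (hint.sub (integrableOn_const measure_ball_lt_top.ne))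
      (integrableOn_ddiff hu hb x ε) measurableSet_ball fun y _ => ?_
    have := h0 (x - ε • y)
    unfold ddiff
    linarith
  set V := volume.real (ball (0 : EuclideanSpace ℝ (Fin N)) 1) with hV
  have h3 : (∫ y in ball (0 : EuclideanSpace ℝ (Fin N)) 1, u (x + ε • y))
      ≤ 2 * (ε ^ 2 * ρ + u x) / β * V := by
    rw [setAverage_eq, smul_eq_mul] at h1
    have h4 : β * (V⁻¹ * ((∫ y in ball (0 : EuclideanSpace ℝ (Fin N)) 1, u (x + ε • y))
        - V * (2 * u x))) ≤ 2 * ε ^ 2 * ρ + 2 * α * u x := by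
      refine le_trans ?_ (by linarith : β * (V⁻¹ * ∫ y in ball (0 : EuclideanSpace ℝ (Fin N)) 1,
        ddiff u x (ε • y)) ≤ 2 * ε ^ 2 * ρ + 2 * α * u x)
      gcongr
    set I := ∫ y in ball (0 : EuclideanSpace ℝ (Fin N)) 1, u (x + ε • y)
    have h5 : β * (V⁻¹ * (I - V * (2 * u x))) = β * I / V - 2 * β * u x := by
      field_simp
    rw [h5] at h4
    have h6 : β * I / V ≤ 2 * (ε ^ 2 * ρ + u x) := by
      have : α = 1 - β := by linarith
      subst this
      linarith
    rw [div_le_iff₀ hpos] at h6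
    rw [div_mul_eq_mul_div, le_div_iff₀ hβ]
    linarith
  have h4 : ∫⁻ y in ball x ε, ENNReal.ofReal (u y)
      = ENNReal.ofReal (ε ^ N) *
        ∫⁻ y in ball (0 : EuclideanSpace ℝ (Fin N)) 1, ENNReal.ofReal (u (x + ε • y)) := by
    have hm : Measure.map (fun y => x + ε • y) (volume : Measure (EuclideanSpace ℝ (Fin N)))
        = ENNReal.ofReal ((ε ^ N)⁻¹) • volume := by
      ext S hS
      rw [Measure.map_apply (by fun_prop) hS, Measure.smul_apply,
        volume_eq_rescale x hε S, smul_eq_mul, ← mul_assoc,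
        ← ENNReal.ofReal_mul (by positivity), inv_mul_cancel₀ (by positivity)]
      simp
    have hp : (fun y : EuclideanSpace ℝ (Fin N) => x + ε • y) ⁻¹' ball x ε = ball 0 1 := by
      ext y
      simp [mem_ball, dist_eq_norm, norm_smul, abs_of_pos hε, mul_lt_iff_lt_one_right hε]
    have := setLIntegral_map (μ := (volume : Measure (EuclideanSpace ℝ (Fin N))))
      (f := fun y => ENNReal.ofReal (u y)) (g := fun y => x + ε • y) (s := ball x ε)
      measurableSet_ball (by fun_prop) (by fun_prop)
    rw [hp, hm, Measure.restrict_smul, lintegral_smul_measure] at this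
    rw [← this, smul_eq_mul, ← mul_assoc, ← ENNReal.ofReal_mul (by positivity),
      mul_inv_cancel₀ (by positivity)]
    simp
  rw [h4, Measure.addHaar_ball _ _ hε.le, finrank_euclideanSpace, Fintype.card_fin,
    ← ofReal_integral_eq_lintegral_ofReal hint (Filter.Eventually.of_forall fun y => h0 _)]
  have h5 : 0 ≤ 2 * (ε ^ 2 * ρ + u x) / β := by
    by_contra hneg
    push Not at hneg
    have : (0 : ℝ) ≤ ∫ y in ball (0 : EuclideanSpace ℝ (Fin N)) 1, u (x + ε • y) :=
      integral_nonneg fun y => h0 _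
    nlinarith
  have h6 : volume (ball (0 : EuclideanSpace ℝ (Fin N)) 1) = ENNReal.ofReal V :=
    (ENNReal.ofReal_toReal measure_ball_lt_top.ne).symm
  rw [h6, ← ENNReal.ofReal_mul (by positivity), ← ENNReal.ofReal_mul (by positivity),
    ← ENNReal.ofReal_mul h5]
  apply ENNReal.ofReal_le_ofReal
  calc _ ≤ ε ^ N * (2 * (ε ^ 2 * ρ + u x) / β * V) := by gcongr
    _ = _ := by ring

lemma one_add_sq_div_two_le_cosh (t : ℝ) : 1 + t ^ 2 / 2 ≤ Real.cosh t := by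
  have h1 : Real.cosh t = 1 + 2 * Real.sinh (t / 2) ^ 2 := by
    have := Real.cosh_two_mul (t / 2)
    rw [mul_div_cancel₀ _ (two_ne_zero)] at this
    rw [this, Real.cosh_sq]
    ring
  have h2 : (t / 2) ^ 2 ≤ Real.sinh (t / 2) ^ 2 := by
    rw [sq_le_sq, Real.abs_sinh]
    exact Real.self_le_sinh_iff.2 (abs_nonneg _)
  rw [h1]
  linarith

/-- The Gaussian barrier, positive exactly in the ball of radius `R`. -/
noncomputable def barrier (A γ R : ℝ) (x : EuclideanSpace ℝ (Fin N)) : ℝ :=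
  A * (Real.exp (-γ * ‖x‖ ^ 2) - Real.exp (-γ * R ^ 2))

lemma ddiff_barrier (A γ R : ℝ) (x h : EuclideanSpace ℝ (Fin N)) :
    ddiff (barrier A γ R) x h = 2 * (A * Real.exp (-γ * ‖x‖ ^ 2)) *
      (Real.exp (-γ * ‖h‖ ^ 2) * Real.cosh (2 * γ * inner ℝ x h) - 1) := by
  have h1 : Real.exp (-γ * ‖x + h‖ ^ 2) = Real.exp (-γ * ‖x‖ ^ 2) * Real.exp (-γ * ‖h‖ ^ 2) *
      Real.exp (-(2 * γ * inner ℝ x h)) := by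
    rw [norm_add_sq_real, ← Real.exp_add, ← Real.exp_add]
    ring_nf
  have h2 : Real.exp (-γ * ‖x - h‖ ^ 2) = Real.exp (-γ * ‖x‖ ^ 2) * Real.exp (-γ * ‖h‖ ^ 2) *
      Real.exp (2 * γ * inner ℝ x h) := by
    rw [norm_sub_sq_real, ← Real.exp_add, ← Real.exp_add]
    ring_nf
  simp only [ddiff, barrier, h1, h2, Real.cosh_eq]
  ring

lemma le_ddiff_barrier {A γ : ℝ} (hA : 0 ≤ A) (R : ℝ) (x h : EuclideanSpace ℝ (Fin N)) :
    -(2 * (A * Real.exp (-γ * ‖x‖ ^ 2)) * (γ * ‖h‖ ^ 2)) ≤ ddiff (barrier A γ R) x h := by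
  rw [ddiff_barrier, ← mul_neg]
  gcongr
  have h1 := Real.add_one_le_exp (-γ * ‖h‖ ^ 2)
  have h2 := Real.one_le_cosh (2 * γ * inner ℝ x h)
  have h3 := mul_le_mul_of_nonneg_left h2 (Real.exp_pos (-γ * ‖h‖ ^ 2)).le
  linarith

lemma le_ddiff_barrier_of_small {A γ : ℝ} (hA : 0 ≤ A) (R : ℝ) (x h : EuclideanSpace ℝ (Fin N))
    (hh : γ * ‖h‖ ^ 2 ≤ 1 / 2) :
    2 * (A * Real.exp (-γ * ‖x‖ ^ 2)) * (-(γ * ‖h‖ ^ 2) + γ ^ 2 * inner ℝ x h ^ 2) ≤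
      ddiff (barrier A γ R) x h := by
  rw [ddiff_barrier]
  gcongr
  have h1 := Real.add_one_le_exp (-γ * ‖h‖ ^ 2)
  have h2 := one_add_sq_div_two_le_cosh (2 * γ * inner ℝ x h)
  have h3 := mul_le_mul_of_nonneg_left h2 (Real.exp_pos (-γ * ‖h‖ ^ 2)).le
  have h4 : 0 ≤ (γ * inner ℝ x h) ^ 2 := sq_nonneg _
  nlinarith

lemma SuperAt.cap_le (hN : 1 ≤ N) (hu : Measurable u) (hb : ∃ K, ∀ x, |u x| ≤ K) (hβ : 0 ≤ β)
    {x : EuclideanSpace ℝ (Fin N)} (h : SuperAt Λ α β ε ρ u x) (e : EuclideanSpace ℝ (Fin N))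
    {m a b : ℝ} (hm : ∀ z ∈ ball (0 : EuclideanSpace ℝ (Fin N)) Λ, m ≤ ddiff u x (ε • z))
    (hb' : ∀ y ∈ ball (0 : EuclideanSpace ℝ (Fin N)) 1, b ≤ ddiff u x (ε • y))
    (hab : ∀ y ∈ ball (0 : EuclideanSpace ℝ (Fin N)) 1, ‖e‖ / 4 ≤ inner ℝ e y →
      b + a ≤ ddiff u x (ε • y)) :
    α * m + β * (b + (1 / 4) ^ N * a) ≤ 2 * ε ^ 2 * ρ := by
  refine le_trans ?_ (h m hm)
  gcongr
  exact le_average_of_le_cap hN (integrableOn_ddiff hu hb x ε) e hb' hab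

/-- `u` is touched from below at `x`, up to an error `η` and within the ball of radius `r`, by
the barrier tilted with slope `p`. -/
def Contact (A γ R r η : ℝ) (u : EuclideanSpace ℝ (Fin N) → ℝ)
    (p x : EuclideanSpace ℝ (Fin N)) : Prop :=
  ∀ z ∈ ball (0 : EuclideanSpace ℝ (Fin N)) r,
    u x - barrier A γ R x - inner ℝ p x - η ≤ u z - barrier A γ R z - inner ℝ p z

section contact

variable {A γ R r η : ℝ} {p q x y : EuclideanSpace ℝ (Fin N)}

lemma add_smul_mem_ball {s : ℝ} (hε : 0 < ε) (hx : ‖x‖ < R) (hs : R + ε * s ≤ r)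
    {z : EuclideanSpace ℝ (Fin N)} (hz : z ∈ ball (0 : EuclideanSpace ℝ (Fin N)) s) :
    x + ε • z ∈ ball (0 : EuclideanSpace ℝ (Fin N)) r ∧
      x - ε • z ∈ ball (0 : EuclideanSpace ℝ (Fin N)) r := by
  rw [mem_ball_zero_iff] at *
  have h1 : ‖ε • z‖ ≤ ε * s := by
    rw [norm_smul, Real.norm_of_nonneg hε.le]
    gcongr
  rw [mem_ball_zero_iff]
  have h2 := norm_add_le x (ε • z)
  have h3 := norm_sub_le x (ε • z)
  constructor <;> linarith

lemma Contact.ddiff_le (h : Contact A γ R r η u p x) {z : EuclideanSpace ℝ (Fin N)}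
    (h1 : x + z ∈ ball (0 : EuclideanSpace ℝ (Fin N)) r)
    (h2 : x - z ∈ ball (0 : EuclideanSpace ℝ (Fin N)) r) :
    ddiff (barrier A γ R) x z - 2 * η ≤ ddiff u x z := by
  have h3 := h _ h1
  have h4 := h _ h2
  rw [inner_add_right] at h3
  rw [inner_sub_right] at h4
  unfold ddiff
  linarith

lemma norm_smul_sq_le {z : EuclideanSpace ℝ (Fin N)} {s : ℝ}
    (hz : z ∈ ball (0 : EuclideanSpace ℝ (Fin N)) s) : ‖ε • z‖ ^ 2 ≤ ε ^ 2 * s ^ 2 := by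
  rw [mem_ball_zero_iff] at hz
  rw [norm_smul, mul_pow, Real.norm_eq_abs, sq_abs]
  gcongr

lemma Contact.norm_lt (hN : 1 ≤ N) (hu : Measurable u) (hb : ∃ K, ∀ x, |u x| ≤ K)
    (hΛ : 1 ≤ Λ) (hα : 0 ≤ α) (hβ : 0 < β) (hαβ : α + β = 1) (hε : 0 < ε) (hρ : 0 < ρ)
    (hA : 0 ≤ A) (hγ : 1 ≤ γ) (hγ' : Λ ^ 2 + 2 ≤ β * (1 / 4) ^ N * γ / 1024)
    (hA' : 3 * ρ ≤ A * Real.exp (-γ * R ^ 2)) (hγε : γ * ε ^ 2 ≤ 1 / 2) (hr : R + ε * Λ ≤ r)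
    (hxR : ‖x‖ < R) (hs : SuperAt Λ α β ε ρ u x)
    (h : Contact A γ R r (ρ * ε ^ 2) u p x) : ‖x‖ < 1 / 8 := by
  by_contra! hx
  set g := A * Real.exp (-γ * ‖x‖ ^ 2) with hg
  have hg0 : 0 ≤ g := by positivity
  have hgρ : 3 * ρ ≤ g := by
    refine hA'.trans ?_
    have : ‖x‖ ^ 2 ≤ R ^ 2 := by gcongr
    have : -γ * R ^ 2 ≤ -γ * ‖x‖ ^ 2 := by nlinarith
    rw [hg]
    gcongr
  have hball : ∀ y ∈ ball (0 : EuclideanSpace ℝ (Fin N)) 1,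
      y ∈ ball (0 : EuclideanSpace ℝ (Fin N)) Λ := fun y hy => ball_subset_ball hΛ hy
  have key := hs.cap_le hN hu hb hβ.le x (m := -(2 * g * (γ * (ε ^ 2 * Λ ^ 2))) - 2 * (ρ * ε ^ 2))
    (b := -(2 * g * (γ * ε ^ 2)) - 2 * (ρ * ε ^ 2))
    (a := 2 * g * (γ ^ 2 * (ε ^ 2 * (‖x‖ ^ 2 / 16))))
    (fun z hz => by
      obtain ⟨h1, h2⟩ := add_smul_mem_ball hε hxR hr hz
      have h3 := h.ddiff_le h1 h2
      have h4 := le_ddiff_barrier (γ := γ) hA R x (ε • z)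
      have h5 : 2 * g * (γ * ‖ε • z‖ ^ 2) ≤ 2 * g * (γ * (ε ^ 2 * Λ ^ 2)) := by
        gcongr
        exact norm_smul_sq_le hz
      linarith)
    (fun z hz => by
      obtain ⟨h1, h2⟩ := add_smul_mem_ball hε hxR hr (hball z hz)
      have h3 := h.ddiff_le h1 h2
      have h4 := le_ddiff_barrier (γ := γ) hA R x (ε • z)
      have hz2 : ‖ε • z‖ ^ 2 ≤ ε ^ 2 := by simpa using norm_smul_sq_le (ε := ε) hz
      have h5 : 2 * g * (γ * ‖ε • z‖ ^ 2) ≤ 2 * g * (γ * ε ^ 2) := by gcongr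
      linarith)
    (fun z hz hxz => by
      obtain ⟨h1, h2⟩ := add_smul_mem_ball hε hxR hr (hball z hz)
      have h3 := h.ddiff_le h1 h2
      have hz2 : ‖ε • z‖ ^ 2 ≤ ε ^ 2 := by simpa using norm_smul_sq_le (ε := ε) hz
      have h4 := le_ddiff_barrier_of_small (γ := γ) hA R x (ε • z)
        ((mul_le_mul_of_nonneg_left hz2 (by linarith)).trans hγε)
      have h5 : 2 * g * (γ * ‖ε • z‖ ^ 2) ≤ 2 * g * (γ * ε ^ 2) := by gcongr
      have h6 : 2 * g * (γ ^ 2 * (ε ^ 2 * (‖x‖ ^ 2 / 16)))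
          ≤ 2 * g * (γ ^ 2 * inner ℝ x (ε • z) ^ 2) := by
        rw [inner_smul_right, mul_pow]
        gcongr
        calc ‖x‖ ^ 2 / 16 = (‖x‖ / 4) ^ 2 := by ring
          _ ≤ _ := by gcongr
      rw [← hg] at h4
      linarith)
  have hx2 : (1 : ℝ) / 64 ≤ ‖x‖ ^ 2 := by nlinarith
  have h1 : Λ ^ 2 + 2 ≤ β * (1 / 4) ^ N * γ * (‖x‖ ^ 2 / 16) := by
    refine hγ'.trans ?_
    have : β * (1 / 4) ^ N * γ / 1024 = β * (1 / 4) ^ N * γ * (1 / 64 / 16) := by ring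
    rw [this]
    gcongr
  have h2 : 1 ≤ γ * (-(α * Λ ^ 2) - β + β * (1 / 4) ^ N * γ * (‖x‖ ^ 2 / 16)) := by
    have : α * Λ ^ 2 ≤ 1 * Λ ^ 2 := by
      gcongr
      linarith
    nlinarith
  have h3 := mul_le_mul_of_nonneg_left h2 (by positivity : 0 ≤ 2 * g * ε ^ 2)
  have h4 : 0 < ε ^ 2 := by positivity
  have hα' : α = 1 - β := by linarith
  subst hα'
  have h5 : 2 * g * ε ^ 2 * 1 ≤ 2 * ε ^ 2 * ρ + 2 * (ρ * ε ^ 2) := by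
    refine h3.trans ?_
    ring_nf at key ⊢
    linarith
  nlinarith

lemma Contact.norm_sub_le (hN : 1 ≤ N) (hu : Measurable u) (hb : ∃ K, ∀ x, |u x| ≤ K)
    (hΛ : 1 ≤ Λ) (hα : 0 ≤ α) (hβ : 0 < β) (hαβ : α + β = 1) (hε : 0 < ε) (hρ : 0 < ρ)
    (hA : 0 ≤ A) (hγ : 0 ≤ γ) (hr : R + ε * Λ ≤ r)
    (hxR : ‖x‖ < R) (hyR : y ∈ ball (0 : EuclideanSpace ℝ (Fin N)) r)
    (hxy : ‖x - y‖ ≤ ε / 8) (hs : SuperAt Λ α β ε ρ u x)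
    (hx : Contact A γ R r (ρ * ε ^ 2) u p x) (hy : Contact A γ R r (ρ * ε ^ 2) u q y) :
    ‖q - p‖ ≤ 8 * 4 ^ N * (5 * ρ + 2 * A * γ * Λ ^ 2) / β * ε := by
  set e := q - p with he
  have hg1 : A * Real.exp (-γ * ‖x‖ ^ 2) ≤ A := by
    have : Real.exp (-γ * ‖x‖ ^ 2) ≤ 1 := Real.exp_le_one_iff.2 (by nlinarith [sq_nonneg ‖x‖])
    nlinarith
  have hball : ∀ y ∈ ball (0 : EuclideanSpace ℝ (Fin N)) 1,
      y ∈ ball (0 : EuclideanSpace ℝ (Fin N)) Λ := fun y hy => ball_subset_ball hΛ hy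
  have hbar : ∀ z ∈ ball (0 : EuclideanSpace ℝ (Fin N)) Λ,
      -(2 * A * (γ * (ε ^ 2 * Λ ^ 2))) ≤ ddiff (barrier A γ R) x (ε • z) := by
    intro z hz
    have h4 := le_ddiff_barrier (γ := γ) hA R x (ε • z)
    have h5 : 2 * (A * Real.exp (-γ * ‖x‖ ^ 2)) * (γ * ‖ε • z‖ ^ 2)
        ≤ 2 * A * (γ * (ε ^ 2 * Λ ^ 2)) := by
      gcongr
      exact norm_smul_sq_le hz
    linarith
  have hρε : 0 < ρ * ε ^ 2 := by positivity
  have h0 : ∀ z ∈ ball (0 : EuclideanSpace ℝ (Fin N)) Λ,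
      -(2 * A * (γ * (ε ^ 2 * Λ ^ 2))) - 3 * (ρ * ε ^ 2) ≤ ddiff u x (ε • z) := by
    intro z hz
    obtain ⟨h1, h2⟩ := add_smul_mem_ball hε hxR hr hz
    have h3 := hx.ddiff_le h1 h2
    have h4 := hbar z hz
    linarith
  have key := hs.cap_le hN hu hb hβ.le e (m := -(2 * A * (γ * (ε ^ 2 * Λ ^ 2))) - 3 * (ρ * ε ^ 2))
    (b := -(2 * A * (γ * (ε ^ 2 * Λ ^ 2))) - 3 * (ρ * ε ^ 2)) (a := ε * ‖e‖ / 8)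
    h0 (fun z hz => h0 z (hball z hz))
    (fun z hz hez => by
      obtain ⟨h1, h2⟩ := add_smul_mem_ball hε hxR hr (hball z hz)
      have h3 := hbar z (hball z hz)
      have h4 := hx _ h2
      have h5 := hy _ h1
      have h6 := hx _ hyR
      have h7 : ε * (‖e‖ / 4) ≤ inner ℝ e (ε • z) := by
        rw [inner_smul_right]
        gcongr
      have h8 : -(‖e‖ * (ε / 8)) ≤ inner ℝ e (x - y) := by
        have := (abs_le.1 (abs_real_inner_le_norm e (x - y))).1
        have : ‖e‖ * ‖x - y‖ ≤ ‖e‖ * (ε / 8) := by gcongr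
        linarith
      simp only [he, inner_sub_left, inner_sub_right, inner_add_right] at h4 h5 h6 h7 h8
      simp only [ddiff] at h3 ⊢
      simp only [he]
      linarith)
  have hα' : α = 1 - β := by linarith
  subst hα'
  have h1 : β * ((1 / 4) ^ N * (ε * ‖e‖ / 8)) ≤ (5 * ρ + 2 * A * γ * Λ ^ 2) * ε * ε := by
    ring_nf at key ⊢
    linarith
  have h2 : β * ((1 / 4) ^ N * (ε * ‖e‖ / 8)) = (β * ‖e‖ / (8 * 4 ^ N)) * ε := by
    rw [one_div, inv_pow]
    field_simp
  rw [h2] at h1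
  have h3 := le_of_mul_le_mul_right h1 hε
  rw [div_le_iff₀ (by positivity)] at h3
  rw [div_mul_eq_mul_div, le_div_iff₀ hβ]
  linarith

end contact

lemma barrier_le {A γ R : ℝ} (hA : 0 ≤ A) (hγ : 0 ≤ γ) (x : EuclideanSpace ℝ (Fin N)) :
    barrier A γ R x ≤ A := by
  have h1 : Real.exp (-γ * ‖x‖ ^ 2) ≤ 1 := Real.exp_le_one_iff.2 (by nlinarith [sq_nonneg ‖x‖])
  have h2 := Real.exp_pos (-γ * R ^ 2)
  unfold barrier
  nlinarith

lemma exists_contact {A γ R r η : ℝ} {p x₀ : EuclideanSpace ℝ (Fin N)} (h0 : ∀ x, 0 ≤ u x)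
    (hA : 0 ≤ A) (hγ : 0 ≤ γ) (hR : 0 ≤ R) (hη : 0 < η) (hη' : η ≤ 1 / 2)
    (hp : ‖p‖ * r ≤ 1 / 4) (hx₀ : x₀ ∈ ball (0 : EuclideanSpace ℝ (Fin N)) r)
    (hux : u x₀ ≤ 3 / 2) (hbx : 3 ≤ barrier A γ R x₀) :
    ∃ x, ‖x‖ < R ∧ u x ≤ A ∧ Contact A γ R r η u p x := by
  set f : EuclideanSpace ℝ (Fin N) → ℝ := fun z => u z - barrier A γ R z - inner ℝ p z with hf
  have hin : ∀ z ∈ ball (0 : EuclideanSpace ℝ (Fin N)) r, |inner ℝ p z| ≤ 1 / 4 := by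
    intro z hz
    refine (abs_real_inner_le_norm p z).trans (le_trans ?_ hp)
    gcongr
    exact (mem_ball_zero_iff.1 hz).le
  have hbdd : BddBelow (f '' ball 0 r) := by
    refine ⟨-A - 1 / 4, ?_⟩
    rintro _ ⟨z, hz, rfl⟩
    have h1 := (abs_le.1 (hin z hz)).2
    have h2 := barrier_le (R := R) hA hγ z
    have h3 := h0 z
    simp only [hf]
    linarith
  obtain ⟨_, ⟨x, hx, rfl⟩, hlt⟩ := exists_lt_of_csInf_lt (s := f '' ball 0 r)
    ⟨_, x₀, hx₀, rfl⟩ (lt_add_of_pos_right _ hη)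
  have hc : ∀ z ∈ ball (0 : EuclideanSpace ℝ (Fin N)) r, f x - η ≤ f z := by
    intro z hz
    have := csInf_le hbdd ⟨z, hz, rfl⟩
    linarith
  have h1 := hc x₀ hx₀
  have h2 := (abs_le.1 (hin x₀ hx₀)).1
  have h3 := (abs_le.1 (hin x hx)).2
  simp only [hf] at h1
  have h4 : u x ≤ barrier A γ R x - 1 / 2 := by linarith
  refine ⟨x, ?_, ?_, hc⟩
  · by_contra! hR'
    have h5 : -γ * ‖x‖ ^ 2 ≤ -γ * R ^ 2 := by
      have : R ^ 2 ≤ ‖x‖ ^ 2 := by gcongr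
      nlinarith
    have h6 := Real.exp_le_exp.2 h5
    have h7 := h0 x
    have h8 : barrier A γ R x ≤ 0 := mul_nonpos_of_nonneg_of_nonpos hA (by linarith)
    linarith
  · have := barrier_le (R := R) hA hγ x
    linarith

lemma exists_mem_grid {h : ℝ} (hh : 0 < h) (x : EuclideanSpace ℝ (Fin N)) :
    ∃ k : Fin N → ℤ, x ∈ hcube (fun i => k i * h) h := by
  refine ⟨fun i => ⌊x i / h⌋, fun i => ⟨?_, ?_⟩⟩
  · exact (le_div_iff₀ hh).1 (Int.floor_le (x i / h))
  · have := (div_lt_iff₀ hh).1 (Int.lt_floor_add_one (x i / h))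
    linarith

lemma disjoint_grid {h : ℝ} (hh : 0 < h) {k l : Fin N → ℤ} (hkl : k ≠ l) :
    Disjoint (hcube (fun i => k i * h) h) (hcube (fun i => l i * h) h) := by
  rw [Set.disjoint_left]
  intro x hx hx'
  apply hkl
  ext i
  have key : ∀ m : ℤ, m * h ≤ x i → x i < m * h + h → m = ⌊x i / h⌋ := by
    intro m h1 h2
    symm
    rw [Int.floor_eq_iff]
    exact ⟨(le_div_iff₀ hh).2 h1, (div_lt_iff₀ hh).2 (by linarith)⟩
  rw [key _ (hx i).1 (hx i).2, key _ (hx' i).1 (hx' i).2]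

lemma norm_sub_le_of_mem_hcube {a : Fin N → ℝ} {h : ℝ} (hh : 0 ≤ h)
    {x y : EuclideanSpace ℝ (Fin N)} (hx : x ∈ hcube a h) (hy : y ∈ hcube a h) :
    ‖x - y‖ ≤ √N * h := by
  refine norm_le_sqrt_mul hh fun i => ?_
  rw [PiLp.sub_apply, abs_le]
  constructor <;> linarith [(hx i).1, (hx i).2, (hy i).1, (hy i).2]

lemma measure_superlevel_le (hu : Measurable u) {M : ℝ} (S : Set (EuclideanSpace ℝ (Fin N))) :
    ENNReal.ofReal M * volume ({z | M < u z} ∩ S) ≤ ∫⁻ z in S, ENNReal.ofReal (u z) := by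
  have h1 := mul_meas_ge_le_lintegral (μ := volume.restrict S)
    (f := fun z => ENNReal.ofReal (u z)) (by fun_prop) (ENNReal.ofReal M)
  refine le_trans (mul_le_mul_right ?_ _) h1
  refine le_trans (measure_mono fun z hz => ?_) (Measure.le_restrict_apply _ _)
  exact ⟨ENNReal.ofReal_le_ofReal (le_of_lt hz.1), hz.2⟩

lemma ofReal_half_le_of_compl {Q : Set (EuclideanSpace ℝ (Fin N))} (hu : Measurable u)
    {M a b : ℝ} (ha : 0 ≤ a) (hQ : volume Q = ENNReal.ofReal b)
    (h : volume ({z | M < u z} ∩ Q) ≤ ENNReal.ofReal a) :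
    ENNReal.ofReal (b - a) ≤ volume ({z | u z ≤ M} ∩ Q) := by
  have hm : MeasurableSet {z | M < u z} := measurableSet_lt measurable_const hu
  have h1 := measure_inter_add_sdiff (μ := volume) Q hm
  have h2 : Q \ {z | M < u z} = {z | u z ≤ M} ∩ Q := by
    ext z
    simp [and_comm]
  rw [h2, Set.inter_comm, hQ] at h1
  rw [ENNReal.ofReal_sub _ ha, ← h1]
  exact tsub_le_iff_left.2 (by gcongr)

set_option maxHeartbeats 2000000 in
lemma measure_estimate (hN : 1 ≤ N) (hΛ : 1 ≤ Λ) (hα : 0 ≤ α) (hβ : 0 < β) (hαβ : α + β = 1) :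
    ∃ ε₀ ρ M μ : ℝ, 0 < ε₀ ∧ ε₀ ≤ 1 ∧ 0 < ρ ∧ 1 ≤ M ∧ μ ∈ Set.Ioo (0 : ℝ) 1 ∧
      ∀ ε : ℝ, 0 < ε → ε ≤ ε₀ → ∀ u : EuclideanSpace ℝ (Fin N) → ℝ, Measurable u →
        (∃ K, ∀ x, |u x| ≤ K) → (∀ x, 0 ≤ u x) →
        (∀ x, ‖x‖ < 5 * √N → SuperAt Λ α β ε ρ u x) →
        ∀ x, (∀ i, |x i| ≤ 3 / 2) → u x ≤ 3 / 2 →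
          volume ({z | M < u z} ∩ hcube (fun _ => -1 / 2) 1) ≤ ENNReal.ofReal μ := by
  have : Nonempty (Fin N) := ⟨⟨0, hN⟩⟩
  set s := √(N : ℝ) with hs
  have hs1 : 1 ≤ s := Real.one_le_sqrt.2 (by exact_mod_cast hN)
  have hs0 : 0 < s := by linarith
  set V := volume.real (ball (0 : EuclideanSpace ℝ (Fin N)) 1) with hV
  have hVpos : 0 < V :=
    ENNReal.toReal_pos (measure_ball_pos _ _ one_pos).ne' measure_ball_lt_top.ne
  have hVo : volume (ball (0 : EuclideanSpace ℝ (Fin N)) 1) = ENNReal.ofReal V :=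
    (ENNReal.ofReal_toReal measure_ball_lt_top.ne).symm
  obtain ⟨γ, hγ1, hγ2⟩ : ∃ γ : ℝ, 1 ≤ γ ∧ Λ ^ 2 + 2 ≤ β * (1 / 4) ^ N * γ / 1024 := by
    refine ⟨max 1 ((Λ ^ 2 + 2) * 1024 / (β * (1 / 4) ^ N)), le_max_left _ _, ?_⟩
    have h1 := le_max_right 1 ((Λ ^ 2 + 2) * 1024 / (β * (1 / 4) ^ N))
    rw [div_le_iff₀ (by positivity)] at h1
    linarith
  have hγ0 : 0 < γ := by linarith
  have hD : 0 < Real.exp (-γ * (s * (3 / 2)) ^ 2) - Real.exp (-γ * (2 * s) ^ 2) := by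
    rw [sub_pos]
    apply Real.exp_lt_exp.2
    have : 0 < γ * s ^ 2 := by positivity
    nlinarith
  obtain ⟨D, hDdef⟩ : ∃ D : ℝ,
      D = Real.exp (-γ * (s * (3 / 2)) ^ 2) - Real.exp (-γ * (2 * s) ^ 2) := ⟨_, rfl⟩
  rw [← hDdef] at hD
  obtain ⟨A, hAdef⟩ : ∃ A : ℝ, A = 3 / D := ⟨_, rfl⟩
  have hA : 0 < A := by rw [hAdef]; positivity
  obtain ⟨ρ, hρ, hρ1, hρ2⟩ : ∃ ρ : ℝ, 0 < ρ ∧ ρ ≤ 1 / 2 ∧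
      3 * ρ ≤ A * Real.exp (-γ * (2 * s) ^ 2) := by
    refine ⟨min (1 / 2) (A * Real.exp (-γ * (2 * s) ^ 2) / 3), by positivity, min_le_left _ _, ?_⟩
    have := min_le_right (1 / 2) (A * Real.exp (-γ * (2 * s) ^ 2) / 3)
    linarith
  obtain ⟨C, hC⟩ : ∃ C : ℝ, C = 8 * 4 ^ N * (5 * ρ + 2 * A * γ * Λ ^ 2) / β := ⟨_, rfl⟩
  have hC0 : 0 < C := by rw [hC]; positivity
  obtain ⟨c₅, hc5⟩ : ∃ c₅ : ℝ, c₅ = 2 * (ρ + A) / β * (8 * s) ^ N * V := ⟨_, rfl⟩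
  have hc50 : 0 < c₅ := by rw [hc5]; positivity
  obtain ⟨κ, hκ⟩ : ∃ κ : ℝ, κ = 1 / (2 * (8 * s * C) ^ N * V) := ⟨_, rfl⟩
  have hκ0 : 0 < κ := by rw [hκ]; positivity
  obtain ⟨θ, hθ⟩ : ∃ θ : ℝ, θ = κ * ((1 / (20 * s)) ^ N * V) := ⟨_, rfl⟩
  have hθ0 : 0 < θ := by rw [hθ]; positivity
  refine ⟨1 / (2 * γ * Λ), ρ, 1 + 2 * c₅, max (1 / 2) (1 - θ), by positivity, ?_, hρ, by linarith,
    ⟨by positivity, max_lt (by norm_num) (by linarith)⟩, ?_⟩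
  · rw [div_le_one (by positivity)]
    nlinarith
  intro ε hε hεε u hu hb h0 hsup x₀ hx₀ hux₀
  rw [le_div_iff₀ (by positivity)] at hεε
  have hγΛ : 1 ≤ γ * Λ := by nlinarith
  have hε1 : ε ≤ 1 := by nlinarith
  have hεΛ : ε * Λ ≤ 1 := by nlinarith [mul_pos hε (by linarith : 0 < Λ)]
  have hεγ : γ * ε ^ 2 ≤ 1 / 2 := by
    have : ε * γ ≤ 1 / 2 := by nlinarith [mul_pos hε hγ0]
    nlinarith [mul_pos hε hγ0]
  have hRr : 2 * s + ε * Λ ≤ 5 * s := by linarith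
  have hx₀n : ‖x₀‖ ≤ s * (3 / 2) := norm_le_sqrt_mul (by norm_num) hx₀
  have hbx₀ : 3 ≤ barrier A γ (2 * s) x₀ := by
    have h1 : Real.exp (-γ * (s * (3 / 2)) ^ 2) ≤ Real.exp (-γ * ‖x₀‖ ^ 2) := by
      apply Real.exp_le_exp.2
      have : ‖x₀‖ ^ 2 ≤ (s * (3 / 2)) ^ 2 := by gcongr
      nlinarith
    calc 3 = A * D := by rw [hAdef]; field_simp
      _ ≤ _ := by
        rw [hDdef]
        unfold barrier
        gcongr
  have hη : 0 < ρ * ε ^ 2 := by positivity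
  have hη' : ρ * ε ^ 2 ≤ 1 / 2 := by nlinarith
  have hex : ∀ p : EuclideanSpace ℝ (Fin N), ‖p‖ < 1 / (20 * s) →
      ∃ x, ‖x‖ < 2 * s ∧ u x ≤ A ∧ Contact A γ (2 * s) (5 * s) (ρ * ε ^ 2) u p x := by
    intro p hp
    refine exists_contact h0 hA.le hγ0.le (by positivity) hη hη' ?_ ?_ hux₀ hbx₀
    · rw [lt_div_iff₀ (by positivity)] at hp
      linarith
    · rw [mem_ball_zero_iff]
      linarith
  choose! X hXR hXA hXc using hex
  have hX8 : ∀ p : EuclideanSpace ℝ (Fin N), ‖p‖ < 1 / (20 * s) → ‖X p‖ < 1 / 8 := fun p hp =>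
    (hXc p hp).norm_lt hN hu hb hΛ hα hβ hαβ hε hρ hA.le hγ1 hγ2 hρ2 hεγ hRr (hXR p hp)
      (hsup _ (by linarith [hXR p hp]))
  obtain ⟨h, hh⟩ : ∃ h : ℝ, h = ε / (8 * s) := ⟨_, rfl⟩
  have hh0 : 0 < h := by rw [hh]; positivity
  have hsh : s * h = ε / 8 := by rw [hh]; field_simp
  set Q : (Fin N → ℤ) → Set (EuclideanSpace ℝ (Fin N)) := fun k => hcube (fun i => k i * h) h
    with hQ
  set Q₁ : Set (EuclideanSpace ℝ (Fin N)) := hcube (fun _ => -1 / 2) 1 with hQ1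
  have hQmeas : MeasurableSet Q₁ := measurableSet_hcube _ _
  have hQvol : volume Q₁ = ENNReal.ofReal 1 := by rw [hQ1, volume_hcube _ zero_le_one, one_pow]
  have hum : MeasurableSet {z | u z ≤ 1 + 2 * c₅} := measurableSet_le hu measurable_const
  have hcell : ∀ k, ENNReal.ofReal κ *
      volume {p ∈ ball (0 : EuclideanSpace ℝ (Fin N)) (1 / (20 * s)) | X p ∈ Q k} ≤
      volume (({z | u z ≤ 1 + 2 * c₅} ∩ Q k) ∩ Q₁) := by
    intro k
    by_cases hne : {p ∈ ball (0 : EuclideanSpace ℝ (Fin N)) (1 / (20 * s)) | X p ∈ Q k}.Nonempty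
    swap
    · rw [Set.not_nonempty_iff_eq_empty.1 hne]
      simp
    obtain ⟨p, hp, hpk⟩ := hne
    rw [mem_ball_zero_iff] at hp
    have hdiam : ∀ z ∈ Q k, ‖X p - z‖ ≤ ε / 8 := by
      intro z hz
      rw [← hsh]
      exact norm_sub_le_of_mem_hcube hh0.le hpk hz
    have hsub1 : Q k ⊆ Q₁ := by
      intro z hz i
      have h1 := norm_sub_rev z (X p)
      have h2 := norm_add_le (z - X p) (X p)
      rw [sub_add_cancel] at h2
      have h3 := (abs_apply_le_norm z i).trans (h2.trans
        (add_le_add (h1.le.trans (hdiam z hz)) (hX8 p hp).le))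
      have h4 := abs_le.1 h3
      constructor <;> linarith [h4.1, h4.2]
    rw [Set.inter_assoc, Set.inter_eq_self_of_subset_left hsub1]
    have hslope : {p ∈ ball (0 : EuclideanSpace ℝ (Fin N)) (1 / (20 * s)) | X p ∈ Q k} ⊆
        closedBall p (C * ε) := by
      rintro q ⟨hq, hqk⟩
      rw [mem_ball_zero_iff] at hq
      rw [mem_closedBall, dist_eq_norm, hC]
      refine (hXc p hp).norm_sub_le hN hu hb hΛ hα hβ hαβ hε hρ hA.le hγ0.le hRr (hXR p hp) ?_
        (hdiam _ hqk) (hsup _ (by linarith [hXR p hp])) (hXc q hq)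
      rw [mem_ball_zero_iff]
      linarith [hXR q hq]
    have hQv : volume (Q k) = ENNReal.ofReal (h ^ N) := volume_hcube _ hh0.le
    have hlow : ENNReal.ofReal (h ^ N - h ^ N / 2) ≤
        volume ({z | u z ≤ 1 + 2 * c₅} ∩ Q k) := by
      refine ofReal_half_le_of_compl hu (by positivity) hQv ?_
      have h1 := measure_superlevel_le hu (M := 1 + 2 * c₅) (Q k)
      have h2 : Q k ⊆ ball (X p) ε := by
        intro z hz
        rw [mem_ball, dist_eq_norm, norm_sub_rev]
        linarith [hdiam z hz]
      have h3 := (hsup (X p) (by linarith [hXR p hp])).lintegral_ball_le hN hu hb h0 hε hα hβ hαβ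
      have h4 := h1.trans ((lintegral_mono_set h2).trans h3)
      rw [Measure.addHaar_ball _ _ hε.le, finrank_euclideanSpace, Fintype.card_fin, hVo,
        ← ENNReal.ofReal_mul (by positivity), ← ENNReal.ofReal_mul (by have := h0 (X p); positivity)]
        at h4
      have h5 : 2 * (ε ^ 2 * ρ + u (X p)) / β * (ε ^ N * V) ≤ (1 + 2 * c₅) * (h ^ N / 2) := by
        have h6 : ε = 8 * s * h := by rw [hh]; field_simp
        have h7 : ε ^ 2 * ρ + u (X p) ≤ ρ + A := by
          have := hXA p hp
          nlinarith
        calc 2 * (ε ^ 2 * ρ + u (X p)) / β * (ε ^ N * V) ≤ 2 * (ρ + A) / β * (ε ^ N * V) := by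
              gcongr
          _ = c₅ * h ^ N := by
              rw [hc5]
              conv_lhs => rw [h6, mul_pow]
              ring
          _ ≤ _ := by
              have : 0 < h ^ N := by positivity
              linarith
      have h8 := h4.trans (ENNReal.ofReal_le_ofReal h5)
      rw [ENNReal.ofReal_mul (by positivity)] at h8
      exact (ENNReal.mul_le_mul_iff_right (by simp; linarith) ENNReal.ofReal_ne_top).1 h8
    refine le_trans ?_ hlow
    calc _ ≤ ENNReal.ofReal κ * volume (closedBall p (C * ε)) := by gcongr
      _ = ENNReal.ofReal (κ * ((C * ε) ^ N * V)) := by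
          rw [Measure.addHaar_closedBall _ _ (by positivity), finrank_euclideanSpace,
            Fintype.card_fin, hVo, ← ENNReal.ofReal_mul (by positivity),
            ← ENNReal.ofReal_mul (by positivity)]
      _ ≤ _ := by
          apply ENNReal.ofReal_le_ofReal
          have h6 : ε = 8 * s * h := by rw [hh]; field_simp
          apply le_of_eq
          have h7 : C * ε = (8 * s * C) * h := by
            conv_lhs => rw [h6]
            ring
          have h8 : 0 < (8 * s * C) ^ N := by positivity
          rw [hκ, h7, mul_pow (8 * s * C)]
          generalize (8 * s * C) ^ N = t at h8 ⊢
          field_simp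
          norm_num
  have hsum : ENNReal.ofReal θ ≤ volume ({z | u z ≤ 1 + 2 * c₅} ∩ Q₁) := by
    calc ENNReal.ofReal θ
        = ENNReal.ofReal κ * volume (ball (0 : EuclideanSpace ℝ (Fin N)) (1 / (20 * s))) := by
          rw [Measure.addHaar_ball _ _ (by positivity), finrank_euclideanSpace,
            Fintype.card_fin, hVo, ← ENNReal.ofReal_mul (by positivity),
            ← ENNReal.ofReal_mul (by positivity), hθ]
      _ ≤ ENNReal.ofReal κ * ∑' k, volume
          {p ∈ ball (0 : EuclideanSpace ℝ (Fin N)) (1 / (20 * s)) | X p ∈ Q k} := by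
          gcongr
          refine le_trans (measure_mono fun p hp => ?_) (measure_iUnion_le _)
          obtain ⟨k, hk⟩ := exists_mem_grid hh0 (X p)
          exact Set.mem_iUnion.2 ⟨k, hp, hk⟩
      _ = ∑' k, ENNReal.ofReal κ * volume
          {p ∈ ball (0 : EuclideanSpace ℝ (Fin N)) (1 / (20 * s)) | X p ∈ Q k} :=
          ENNReal.tsum_mul_left.symm
      _ ≤ ∑' k, volume (({z | u z ≤ 1 + 2 * c₅} ∩ Q k) ∩ Q₁) := ENNReal.tsum_le_tsum hcell
      _ = volume (⋃ k, ({z | u z ≤ 1 + 2 * c₅} ∩ Q k) ∩ Q₁) := by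
          refine (measure_iUnion (fun k l hkl => ?_) fun k =>
            (hum.inter (measurableSet_hcube _ _)).inter hQmeas).symm
          exact (disjoint_grid hh0 hkl).mono (fun z hz => hz.1.2) (fun z hz => hz.1.2)
      _ ≤ _ := by
          refine measure_mono (Set.iUnion_subset fun k => ?_)
          exact fun z hz => ⟨hz.1.1, hz.2⟩
  have hdiff : {z | 1 + 2 * c₅ < u z} ∩ Q₁ = Q₁ \ ({z | u z ≤ 1 + 2 * c₅} ∩ Q₁) := by
    ext z
    simp only [Set.mem_inter_iff, Set.mem_sdiff, Set.mem_ofPred_eq, not_and, ← not_le]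
    tauto
  rw [hdiff, measure_sdiff Set.inter_subset_right (hum.inter hQmeas).nullMeasurableSet
    (ne_top_of_le_ne_top (by rw [hQvol]; exact ENNReal.ofReal_ne_top)
      (measure_mono Set.inter_subset_right)), hQvol]
  refine (tsub_le_tsub_left hsum _).trans ?_
  rw [← ENNReal.ofReal_sub _ hθ0.le]
  exact ENNReal.ofReal_le_ofReal (le_max_right _ _)

lemma SuperAt.exists_le_of_ball_subset (hN : 1 ≤ N) (hu : Measurable u)
    (hb : ∃ K, ∀ x, |u x| ≤ K) (h0 : ∀ x, 0 ≤ u x) (hε : 0 < ε) (hε1 : ε ≤ 1) (hα : 0 ≤ α)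
    (hβ : 0 < β) (hαβ : α + β = 1) (hρ : 0 < ρ) {x y : EuclideanSpace ℝ (Fin N)} {C : ℝ}
    (h : SuperAt Λ α β ε ρ u x) (hC : u x ≤ C) (hxy : ball y (ε / 4) ⊆ ball x ε) :
    ∃ z ∈ ball y (ε / 4), u z ≤ 2 * (ρ + C) / β * 4 ^ N + 1 := by
  by_contra! hne
  have hC0 : 0 ≤ C := (h0 x).trans hC
  have hVpos : 0 < volume.real (ball (0 : EuclideanSpace ℝ (Fin N)) 1) :=
    ENNReal.toReal_pos (measure_ball_pos _ _ one_pos).ne' measure_ball_lt_top.ne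
  have hVo : volume (ball (0 : EuclideanSpace ℝ (Fin N)) 1) =
      ENNReal.ofReal (volume.real (ball (0 : EuclideanSpace ℝ (Fin N)) 1)) :=
    (ENNReal.ofReal_toReal measure_ball_lt_top.ne).symm
  have : Nonempty (Fin N) := ⟨⟨0, hN⟩⟩
  have h1 := (measure_superlevel_le hu (M := 2 * (ρ + C) / β * 4 ^ N + 1) (ball y (ε / 4))).trans
    ((lintegral_mono_set hxy).trans (h.lintegral_ball_le hN hu hb h0 hε hα hβ hαβ))
  have hsub : ball y (ε / 4) ⊆ {z | 2 * (ρ + C) / β * 4 ^ N + 1 < u z} := hne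
  rw [Set.inter_eq_self_of_subset_right hsub, Measure.addHaar_ball _ _ hε.le,
    Measure.addHaar_ball _ _ (by positivity), finrank_euclideanSpace, Fintype.card_fin, hVo,
    ← ENNReal.ofReal_mul (by positivity), ← ENNReal.ofReal_mul (by positivity),
    ← ENNReal.ofReal_mul (by positivity), ← ENNReal.ofReal_mul (by have := h0 x; positivity),
    ENNReal.ofReal_le_ofReal_iff (by have := h0 x; positivity)] at h1
  set V := volume.real (ball (0 : EuclideanSpace ℝ (Fin N)) 1)
  have h2 : 2 * (ε ^ 2 * ρ + u x) / β ≤ 2 * (ρ + C) / β := by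
    have : ε ^ 2 * ρ + u x ≤ ρ + C :=
      add_le_add (mul_le_of_le_one_left hρ.le (pow_le_one₀ hε.le hε1)) hC
    gcongr
  have h3 : 0 < (ε / 4) ^ N * V := by positivity
  have h4 : ε ^ N * V = 4 ^ N * ((ε / 4) ^ N * V) := by
    rw [← mul_assoc, ← mul_pow, mul_div_cancel₀ _ (by norm_num)]
  rw [h4, ← mul_assoc (2 * (ε ^ 2 * ρ + u x) / β)] at h1
  have h5 := le_of_mul_le_mul_right h1 h3
  have h6 : 2 * (ε ^ 2 * ρ + u x) / β * 4 ^ N ≤ 2 * (ρ + C) / β * 4 ^ N := by gcongr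
  linarith

/-- The bound propagated along a chain of `n` steps in the Harnack-type argument. -/
noncomputable def chainBound (N : ℕ) (β ρ : ℝ) : ℕ → ℝ
  | 0 => 1
  | n + 1 => 2 * (ρ + chainBound N β ρ n) / β * 4 ^ N + 1

lemma exists_le_chainBound (hN : 1 ≤ N) (hu : Measurable u) (hb : ∃ K, ∀ x, |u x| ≤ K)
    (h0 : ∀ x, 0 ≤ u x) (hε : 0 < ε) (hε1 : ε ≤ 1) (hα : 0 ≤ α) (hβ : 0 < β) (hαβ : α + β = 1)
    (hρ : 0 < ρ) (h : ∀ x, ‖x‖ < 5 * √N → SuperAt Λ α β ε ρ u x)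
    {x : EuclideanSpace ℝ (Fin N)} (hx : ‖x‖ ≤ √N) (hux : u x ≤ 1) (n : ℕ)
    {y : EuclideanSpace ℝ (Fin N)} (hy : ‖y‖ ≤ √N) (hxy : ‖y - x‖ ≤ n * (ε / 2)) :
    ∃ z ∈ ball y (ε / 4), u z ≤ chainBound N β ρ n := by
  induction n generalizing y with
  | zero =>
    have : y = x := by
      rw [Nat.cast_zero, zero_mul, norm_le_zero_iff, sub_eq_zero] at hxy
      exact hxy
    exact ⟨x, by rw [this]; exact mem_ball_self (by positivity), hux⟩
  | succ n ih =>
    have hs1 : 1 ≤ √(N : ℝ) := Real.one_le_sqrt.2 (by exact_mod_cast hN)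
    push_cast at hxy
    set y' := x + (n / (n + 1) : ℝ) • (y - x) with hy'
    have hn1 : ‖y' - x‖ ≤ n * (ε / 2) := by
      rw [hy', add_sub_cancel_left, norm_smul, Real.norm_of_nonneg (by positivity)]
      calc _ ≤ (n / (n + 1) : ℝ) * ((n + 1) * (ε / 2)) := by gcongr
        _ = _ := by field_simp
    have hn2 : ‖y - y'‖ ≤ ε / 2 := by
      have : y - y' = (1 / (n + 1) : ℝ) • (y - x) := by
        have h1 : (1 / (n + 1) : ℝ) = 1 - n / (n + 1) := by field_simp; ring
        rw [h1, hy', sub_smul, one_smul]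
        abel
      rw [this, norm_smul, Real.norm_of_nonneg (by positivity)]
      calc _ ≤ (1 / (n + 1) : ℝ) * ((n + 1) * (ε / 2)) := by gcongr
        _ = _ := by field_simp
    have hn3 : ‖y'‖ ≤ √N := by
      have h1 : y' ∈ segment ℝ x y := by
        rw [segment_eq_image']
        exact ⟨n / (n + 1), ⟨by positivity, by rw [div_le_one (by positivity)]; linarith⟩, rfl⟩
      have h2 := (convex_closedBall (0 : EuclideanSpace ℝ (Fin N)) (√N)).segment_subset
        (mem_closedBall_zero_iff.2 hx) (mem_closedBall_zero_iff.2 hy) h1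
      exact mem_closedBall_zero_iff.1 h2
    obtain ⟨z, hz, huz⟩ := ih hn3 hn1
    rw [mem_ball, dist_eq_norm] at hz
    refine (h z ?_).exists_le_of_ball_subset hN hu hb h0 hε hε1 hα hβ hαβ hρ huz ?_
    · have := norm_le_norm_add_norm_sub' z y'
      linarith
    · refine ball_subset_ball' ?_
      have h1 := dist_triangle y y' z
      rw [dist_eq_norm y y', dist_eq_norm y' z, norm_sub_rev y' z] at h1
      linarith

lemma medium_scale_estimate (hN : 1 ≤ N) (hα : 0 ≤ α) (hβ : 0 < β) (hαβ : α + β = 1)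
    {ε₀ : ℝ} (hε₀ : 0 < ε₀) (hε₀1 : ε₀ ≤ 1) (hρ : 0 < ρ) :
    ∃ c : ℝ, 0 < c ∧ ∀ ε : ℝ, ε₀ / 2 < ε → ε ≤ ε₀ → ∀ u : EuclideanSpace ℝ (Fin N) → ℝ,
      Measurable u → (∃ K, ∀ x, |u x| ≤ K) → (∀ x, 0 ≤ u x) →
      (∀ x, ‖x‖ < 5 * √N → SuperAt Λ α β ε ρ u x) →
      ∀ x ∈ hcube (fun _ => -1 / 2) 1, u x ≤ 1 → ∀ K : ℝ, 0 < K →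
        volume ({z | K < u z} ∩ hcube (fun _ => -1 / 2) 1) ≤ ENNReal.ofReal (c / K) := by
  have : Nonempty (Fin N) := ⟨⟨0, hN⟩⟩
  have hs1 : 1 ≤ √(N : ℝ) := Real.one_le_sqrt.2 (by exact_mod_cast hN)
  obtain ⟨t, hts, htf, htc⟩ := (isCompact_closedBall (0 : EuclideanSpace ℝ (Fin N))
    (√N / 2)).finite_cover_balls (e := ε₀ / 8) (by positivity)
  lift t to Finset (EuclideanSpace ℝ (Fin N)) using htf
  obtain ⟨n, hn⟩ := exists_nat_ge (4 * √N / ε₀)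
  rw [div_le_iff₀ hε₀] at hn
  have hVpos : 0 < volume.real (ball (0 : EuclideanSpace ℝ (Fin N)) 1) :=
    ENNReal.toReal_pos (measure_ball_pos _ _ one_pos).ne' measure_ball_lt_top.ne
  have hVo : volume (ball (0 : EuclideanSpace ℝ (Fin N)) 1) =
      ENNReal.ofReal (volume.real (ball (0 : EuclideanSpace ℝ (Fin N)) 1)) :=
    (ENNReal.ofReal_toReal measure_ball_lt_top.ne).symm
  set V := volume.real (ball (0 : EuclideanSpace ℝ (Fin N)) 1)
  have hCn : ∀ n, 0 < chainBound N β ρ n := by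
    intro n
    induction n with
    | zero => exact one_pos
    | succ n ih => rw [chainBound]; positivity
  have hCn := hCn n
  set C := chainBound N β ρ n with hC
  have hQ : hcube (fun _ => -1 / 2) 1 ⊆ closedBall (0 : EuclideanSpace ℝ (Fin N)) (√N / 2) := by
    intro z hz
    rw [mem_closedBall_zero_iff, div_eq_mul_one_div]
    refine norm_le_sqrt_mul (by norm_num) fun i => abs_le.2 ?_
    constructor <;> linarith [(hz i).1, (hz i).2]
  refine ⟨t.card * (2 * (ρ + C) / β * V) + 1, by positivity, ?_⟩
  intro ε hε hεε u hu hb h0 h x hx hux K hK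
  have hε0 : 0 < ε := by linarith
  have hε1 : ε ≤ 1 := hεε.trans hε₀1
  have hxn := mem_closedBall_zero_iff.1 (hQ hx)
  have hball : ∀ y ∈ t, ∫⁻ z in ball y (ε₀ / 8), ENNReal.ofReal (u z) ≤
      ENNReal.ofReal (2 * (ρ + C) / β * V) := by
    intro y hy
    have hyn := mem_closedBall_zero_iff.1 (hts hy)
    have h1 : ‖y - x‖ ≤ n * (ε / 2) := by
      have := norm_sub_le y x
      nlinarith
    obtain ⟨z, hz, huz⟩ := exists_le_chainBound hN hu hb h0 hε0 hε1 hα hβ hαβ hρ h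
      (by linarith) hux n (y := y) (by linarith) h1
    rw [mem_ball, dist_comm] at hz
    have hzn : ‖z‖ < 5 * √N := by
      have := norm_le_norm_add_norm_sub' z y
      rw [← dist_eq_norm z y, dist_comm] at this
      linarith
    refine (lintegral_mono_set (ball_subset_ball' (by linarith : ε₀ / 8 + dist y z ≤ ε))).trans
      (((h z hzn).lintegral_ball_le hN hu hb h0 hε0 hα hβ hαβ).trans ?_)
    have huz0 := h0 z
    rw [Measure.addHaar_ball _ _ hε0.le, finrank_euclideanSpace, Fintype.card_fin, hVo,
      ← ENNReal.ofReal_mul (by positivity), ← ENNReal.ofReal_mul (by positivity)]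
    apply ENNReal.ofReal_le_ofReal
    have h2 : ε ^ 2 * ρ + u z ≤ ρ + C :=
      add_le_add (mul_le_of_le_one_left hρ.le (pow_le_one₀ hε0.le hε1)) huz
    have h3 : ε ^ N ≤ 1 := pow_le_one₀ hε0.le hε1
    calc _ ≤ 2 * (ρ + C) / β * (1 * V) := by gcongr
      _ = _ := by ring
  have hmain : ENNReal.ofReal K * volume ({z | K < u z} ∩ hcube (fun _ => -1 / 2) 1) ≤
      ENNReal.ofReal (t.card * (2 * (ρ + C) / β * V) + 1) := by
    calc _ ≤ ∫⁻ z in hcube (fun _ => -1 / 2) 1, ENNReal.ofReal (u z) :=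
          measure_superlevel_le hu _
      _ ≤ ∫⁻ z in ⋃ y ∈ t, ball y (ε₀ / 8), ENNReal.ofReal (u z) :=
          lintegral_mono_set (hQ.trans htc)
      _ ≤ ∑ y ∈ t, ∫⁻ z in ball y (ε₀ / 8), ENNReal.ofReal (u z) := by
          have h1 := lintegral_iUnion_le (μ := volume)
            (fun y : t => ball (y : EuclideanSpace ℝ (Fin N)) (ε₀ / 8))
            (fun z => ENNReal.ofReal (u z))
          rw [tsum_fintype, Finset.sum_coe_sort t
            (fun y => ∫⁻ z in ball y (ε₀ / 8), ENNReal.ofReal (u z))] at h1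
          refine le_trans (le_of_eq ?_) h1
          congr 2
          exact Set.biUnion_eq_iUnion _ _
      _ ≤ ∑ y ∈ t, ENNReal.ofReal (2 * (ρ + C) / β * V) := Finset.sum_le_sum hball
      _ = ENNReal.ofReal (t.card * (2 * (ρ + C) / β * V)) := by
          rw [Finset.sum_const, nsmul_eq_mul, ENNReal.ofReal_mul (Nat.cast_nonneg _),
            ENNReal.ofReal_natCast]
      _ ≤ _ := ENNReal.ofReal_le_ofReal (by linarith)
  rw [ENNReal.ofReal_div_of_pos hK, ENNReal.le_div_iff_mul_le (by simp [hK]) (by simp), mul_comm]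
  exact hmain

/-- The center of `hcube a r`. -/
noncomputable def center (a : Fin N → ℝ) (r : ℝ) : EuclideanSpace ℝ (Fin N) :=
  WithLp.toLp 2 fun i => a i + r / 2

lemma center_add_smul_apply (a : Fin N → ℝ) (r : ℝ) (y : EuclideanSpace ℝ (Fin N)) (i : Fin N) :
    (center a r + r • y) i = a i + r / 2 + r * y i := by
  simp [center]

/-- The function `u` on `hcube a r` transported to the unit cube and divided by `t`. -/
noncomputable def normalized (u : EuclideanSpace ℝ (Fin N) → ℝ) (a : Fin N → ℝ) (r t : ℝ) :
    EuclideanSpace ℝ (Fin N) → ℝ :=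
  fun y => u (center a r + r • y) / t

lemma measurable_normalized (hu : Measurable u) (a : Fin N → ℝ) (r t : ℝ) :
    Measurable (normalized u a r t) := by
  unfold normalized
  fun_prop

lemma bounded_normalized (hb : ∃ K, ∀ x, |u x| ≤ K) (a : Fin N → ℝ) (r t : ℝ) :
    ∃ K, ∀ x, |normalized u a r t x| ≤ K := by
  obtain ⟨K, hK⟩ := hb
  refine ⟨K / |t|, fun x => ?_⟩
  rw [normalized, abs_div]
  gcongr
  exact hK _

lemma normalized_nonneg (h0 : ∀ x, 0 ≤ u x) (a : Fin N → ℝ) (r : ℝ) {t : ℝ} (ht : 0 ≤ t)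
    (x : EuclideanSpace ℝ (Fin N)) : 0 ≤ normalized u a r t x :=
  div_nonneg (h0 _) ht

lemma superAt_normalized {a : Fin N → ℝ} {r t : ℝ} (hr : 0 < r) (hr1 : r ≤ 1) (ht : 1 ≤ t)
    (hρ : 0 ≤ ρ) (ha : ∀ i, -1 / 2 ≤ a i ∧ a i + r ≤ 1 / 2) (hN : 1 ≤ N)
    (h : ∀ x ∈ cube (fun _ : Fin N => (0 : ℝ)) (10 * √N), SuperAt Λ α β ε ρ u x)
    {x : EuclideanSpace ℝ (Fin N)} (hx : ‖x‖ < 5 * √N) :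
    SuperAt Λ α β (ε / r) ρ (normalized u a r t) x := by
  have hs1 : 1 ≤ √(N : ℝ) := Real.one_le_sqrt.2 (by exact_mod_cast hN)
  refine ((h (center a r + r • x) fun i => ?_).rescale hr (by linarith)).mono ?_
  · rw [center_add_smul_apply, sub_zero, abs_lt]
    have h1 := abs_lt.1 ((abs_apply_le_norm x i).trans_lt hx)
    have h2 := ha i
    constructor <;> nlinarith [mul_pos hr (sub_pos.2 h1.1), mul_pos hr (sub_pos.2 h1.2)]
  · refine mul_le_of_le_one_left hρ ?_
    rw [div_le_one (by linarith)]
    exact (pow_le_one₀ hr.le hr1).trans ht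

lemma volume_superlevel_inter_hcube (a : Fin N → ℝ) {r t M : ℝ} (hr : 0 < r) (ht : 0 < t) :
    volume ({z | M * t < u z} ∩ hcube a r) =
      ENNReal.ofReal (r ^ N) *
        volume ({y | M < normalized u a r t y} ∩ hcube (fun _ => -1 / 2) 1) := by
  rw [volume_eq_rescale (center a r) hr]
  congr 2
  ext y
  simp only [Set.mem_preimage, Set.mem_inter_iff, Set.mem_ofPred_eq, normalized, lt_div_iff₀ ht,
    hcube, center_add_smul_apply]
  refine and_congr_right fun _ => forall_congr' fun i => ?_
  constructor <;> rintro ⟨h1, h2⟩ <;> constructor <;> nlinarith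

lemma exists_normalized_eq (a : Fin N → ℝ) {r : ℝ} (hr : 0 < r) (t : ℝ)
    (x : EuclideanSpace ℝ (Fin N)) :
    ∃ y : EuclideanSpace ℝ (Fin N), normalized u a r t y = u x / t ∧
      ∀ i, x i = a i + r / 2 + r * y i := by
  have h : center a r + r • (r⁻¹ • (x - center a r)) = x := by
    rw [smul_inv_smul₀ hr.ne', add_sub_cancel]
  refine ⟨r⁻¹ • (x - center a r), by rw [normalized, h], fun i => ?_⟩
  rw [← center_add_smul_apply, h]

/-- The lower corners of the `2 ^ N` dyadic children of `hcube a r`. -/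
noncomputable def child (a : Fin N → ℝ) (r : ℝ) (σ : Fin N → Bool) : Fin N → ℝ :=
  fun i => a i + if σ i then r / 2 else 0

lemma iUnion_child (a : Fin N → ℝ) (r : ℝ) : ⋃ σ, hcube (child a r σ) (r / 2) = hcube a r := by
  ext x
  simp only [Set.mem_iUnion, hcube, child, Set.mem_ofPred_eq]
  constructor
  · rintro ⟨σ, h⟩ i
    have := h i
    split_ifs at this <;> constructor <;> linarith [this.1, this.2]
  · intro h
    refine ⟨fun i => decide (a i + r / 2 ≤ x i), fun i => ?_⟩
    have := h i
    simp only [decide_eq_true_eq]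
    split_ifs with h1 <;> constructor <;> linarith [this.1, this.2]

lemma disjoint_child (a : Fin N → ℝ) (r : ℝ) :
    Pairwise fun σ τ => Disjoint (hcube (child a r σ) (r / 2)) (hcube (child a r τ) (r / 2)) := by
  intro σ τ h
  refine Set.disjoint_left.2 fun x hx hy => h (funext fun i => ?_)
  have h1 := hx i
  have h2 := hy i
  simp only [child] at h1 h2
  cases hσ : σ i <;> cases hτ : τ i <;> simp [hσ, hτ] at h1 h2 ⊢ <;> linarith

lemma sum_volume_inter_child {S : Set (EuclideanSpace ℝ (Fin N))} (hS : MeasurableSet S)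
    (a : Fin N → ℝ) (r : ℝ) :
    ∑ σ, volume (S ∩ hcube (child a r σ) (r / 2)) = volume (S ∩ hcube a r) := by
  rw [← iUnion_child a r, Set.inter_iUnion, measure_iUnion
    (fun σ τ h => (disjoint_child a r h).mono Set.inter_subset_right Set.inter_subset_right)
    fun σ => hS.inter (measurableSet_hcube _ _), tsum_fintype]

/-- A Calderón–Zygmund type covering argument stopped at scale `ε / ε₀`. -/
lemma volume_inter_hcube_le_of_dyadic {ε₀ t : ℝ} {m κ : ENNReal} (hε : 0 < ε)
    (hu : Measurable u) {A : Set (EuclideanSpace ℝ (Fin N))} (hA : MeasurableSet A)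
    (hbasic : ∀ (a : Fin N → ℝ) (r : ℝ), 0 < r → (∀ i, -1 / 2 ≤ a i ∧ a i + r ≤ 1 / 2) →
      ε ≤ ε₀ * r → ∀ x : EuclideanSpace ℝ (Fin N), (∀ i, |x i - (a i + r / 2)| ≤ 3 / 2 * r) →
        u x ≤ t → volume (A ∩ hcube a r) ≤ m * volume (hcube a r))
    (hmed : ∀ (a : Fin N → ℝ) (r : ℝ), 0 < r → (∀ i, -1 / 2 ≤ a i ∧ a i + r ≤ 1 / 2) →
      ε ≤ ε₀ * r → ε₀ * r < 2 * ε → ∀ x ∈ hcube a r, u x ≤ t →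
        volume (A ∩ hcube a r) ≤ κ * volume (hcube a r))
    (L : ℕ) {a : Fin N → ℝ} {r : ℝ} (hr : 0 < r) (ha : ∀ i, -1 / 2 ≤ a i ∧ a i + r ≤ 1 / 2)
    (hL : ε * 2 ^ L ≤ ε₀ * r) (hL' : ε₀ * r < ε * 2 ^ (L + 1))
    (h : volume (A ∩ hcube a r) ≤ m * volume (hcube a r)) :
    volume (A ∩ hcube a r) ≤
      m * volume ({x | t < u x} ∩ hcube a r) + κ * volume (hcube a r) := by
  induction L generalizing a r with
  | zero =>
    by_cases hex : ∃ x ∈ hcube a r, u x ≤ t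
    · obtain ⟨x, hx, hux⟩ := hex
      refine (hmed a r hr ha (by simpa using hL) ?_ x hx hux).trans le_add_self
      rw [zero_add, pow_one] at hL'
      linarith
    · push Not at hex
      rw [Set.inter_eq_self_of_subset_right (s := {x | t < u x}) (fun x hx => hex x hx)]
      exact h.trans le_self_add
  | succ L ih =>
    by_cases hex : ∃ x ∈ hcube a r, u x ≤ t
    · obtain ⟨x, hx, hux⟩ := hex
      rw [pow_succ] at hL
      rw [pow_succ] at hL'
      have hchild : ∀ i σ, child a r σ i = a i ∨ child a r σ i = a i + r / 2 := by
        intro i σ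
        unfold child
        split_ifs <;> simp
      have key : ∀ σ, volume (A ∩ hcube (child a r σ) (r / 2)) ≤
          m * volume ({x | t < u x} ∩ hcube (child a r σ) (r / 2)) +
            κ * volume (hcube (child a r σ) (r / 2)) := by
        intro σ
        have hσ : ∀ i, -1 / 2 ≤ child a r σ i ∧ child a r σ i + r / 2 ≤ 1 / 2 := by
          intro i
          rcases hchild i σ with h1 | h1 <;> rw [h1] <;> constructor <;>
            linarith [(ha i).1, (ha i).2]
        refine ih (by linarith) hσ (by linarith) (by linarith)
          (hbasic _ _ (by linarith) hσ ?_ x (fun i => ?_) hux)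
        · have : ε * 1 ≤ ε * 2 ^ L := by
            gcongr
            exact one_le_pow₀ one_le_two
          linarith
        · rw [abs_le]
          rcases hchild i σ with h1 | h1 <;> rw [h1] <;> constructor <;>
            linarith [(hx i).1, (hx i).2]
      rw [← sum_volume_inter_child hA,
        ← sum_volume_inter_child (measurableSet_lt measurable_const hu),
        ← Set.univ_inter (hcube a r), ← sum_volume_inter_child MeasurableSet.univ,
        Finset.mul_sum, Finset.mul_sum, ← Finset.sum_add_distrib]
      refine Finset.sum_le_sum fun σ _ => ?_
      rw [Set.univ_inter]
      exact key σ
    · push Not at hex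
      rw [Set.inter_eq_self_of_subset_right (s := {x | t < u x}) (fun x hx => hex x hx)]
      exact h.trans le_self_add

end

/-- **Lemma `lem:main`.** There exist `ε₀ > 0`, `ρ > 0`, `c > 0`, `M ≥ 1` and
`μ ∈ (0,1)`, depending only on `N, Λ, α, β`, such that: if `u` is bounded Borel measurable
with `L_ε^- u ≤ ρ` in `Q_{10√N}` and `u ≥ 0` in `ℝ^N`, for some `0 < ε ≤ ε₀`, and
`inf_{Q_3} u ≤ 1`, then `|{u > K^k} ∩ Q_1| ≤ c/((1−μ)K) + μ^k` for every `K ≥ M` and `k ∈ ℕ`. -/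
theorem superlevel_iteration (N : ℕ) (hN : 1 ≤ N) (Λ α β : ℝ) (hΛ : 1 ≤ Λ)
    (hβ : β ∈ Set.Ioc (0 : ℝ) 1) (hα : α = 1 - β) :
    ∃ (ε₀ ρ c M μ : ℝ), 0 < ε₀ ∧ 0 < ρ ∧ 0 < c ∧ 1 ≤ M ∧ μ ∈ Set.Ioo (0 : ℝ) 1 ∧
      ∀ ε : ℝ, 0 < ε → ε ≤ ε₀ →
        ∀ u : EuclideanSpace ℝ (Fin N) → ℝ,
          Measurable u → (∃ K, ∀ x, |u x| ≤ K) →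
          (∀ x ∈ cube (fun _ : Fin N => (0 : ℝ)) (10 * Real.sqrt N),
            Lminus Λ α β ε u x ≤ ρ) →
          (∀ x, 0 ≤ u x) →
          sInf (u '' cube (fun _ : Fin N => (0 : ℝ)) 3) ≤ 1 →
          ∀ K : ℝ, M ≤ K → ∀ k : ℕ, 1 ≤ k →
            volume ({x | K ^ k < u x} ∩ cube (fun _ : Fin N => (0 : ℝ)) 1) ≤
              ENNReal.ofReal (c / ((1 - μ) * K) + μ ^ k) := by
  have hα0 : 0 ≤ α := by linarith [hβ.2]
  have hαβ : α + β = 1 := by linarith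
  obtain ⟨ε₀, ρ, M, μ, hε₀, hε₀1, hρ, hM, hμ, hbase⟩ := measure_estimate hN hΛ hα0 hβ.1 hαβ
  obtain ⟨c, hc, hmedium⟩ :=
    medium_scale_estimate (Λ := Λ) hN hα0 hβ.1 hαβ hε₀ hε₀1 hρ
  refine ⟨ε₀, ρ, c, M, μ, hε₀, hρ, hc, hM, hμ, ?_⟩
  intro ε hε hεε u hu hb hL h0 hinf K hK
  have hK1 : 1 ≤ K := hM.trans hK
  have hK0 : 0 < K := by linarith
  have hμ1 : 0 < 1 - μ := sub_pos.2 hμ.2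
  have hsup := fun x hx => superAt_of_Lminus_le (by linarith : 0 < Λ) hα0 hε (hL x hx)
  have hbasic : ∀ t : ℝ, 1 ≤ t → ∀ (a : Fin N → ℝ) (r : ℝ), 0 < r →
      (∀ i, -1 / 2 ≤ a i ∧ a i + r ≤ 1 / 2) → ε ≤ ε₀ * r → ∀ x : EuclideanSpace ℝ (Fin N),
        (∀ i, |x i - (a i + r / 2)| ≤ 3 / 2 * r) → u x ≤ 3 / 2 * t →
          volume ({x | K * t < u x} ∩ hcube a r) ≤ ENNReal.ofReal μ * volume (hcube a r) := by
    intro t ht a r hr ha hεr x hx hux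
    have ht0 : 0 < t := by linarith
    have hr1 : r ≤ 1 := by linarith [(ha ⟨0, hN⟩).1, (ha ⟨0, hN⟩).2]
    obtain ⟨y, hy, hxy⟩ := exists_normalized_eq (u := u) a hr t x
    have h1 := hbase (ε / r) (by positivity) (by rwa [div_le_iff₀ hr]) (normalized u a r t)
      (measurable_normalized hu a r t) (bounded_normalized hb a r t)
      (normalized_nonneg h0 a r ht0.le)
      (fun z hz => superAt_normalized hr hr1 ht hρ.le ha hN hsup hz) y
      (fun i => ?_) (by rw [hy, div_le_iff₀ ht0]; exact hux)
    · rw [volume_superlevel_inter_hcube a hr ht0, volume_hcube a hr.le, mul_comm]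
      gcongr
      refine le_trans (measure_mono ?_) h1
      exact Set.inter_subset_inter_left _ fun z hz => lt_of_le_of_lt hK hz
    · have h2 := hx i
      rw [hxy i, add_sub_cancel_left, abs_mul, abs_of_pos hr, mul_comm] at h2
      exact le_of_mul_le_mul_right h2 hr
  have hmed : ∀ t : ℝ, 1 ≤ t → ∀ (a : Fin N → ℝ) (r : ℝ), 0 < r →
      (∀ i, -1 / 2 ≤ a i ∧ a i + r ≤ 1 / 2) → ε ≤ ε₀ * r → ε₀ * r < 2 * ε →
        ∀ x ∈ hcube a r, u x ≤ t →
          volume ({x | K * t < u x} ∩ hcube a r) ≤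
            ENNReal.ofReal (c / K) * volume (hcube a r) := by
    intro t ht a r hr ha hεr hεr' x hx hux
    have ht0 : 0 < t := by linarith
    have hr1 : r ≤ 1 := by linarith [(ha ⟨0, hN⟩).1, (ha ⟨0, hN⟩).2]
    obtain ⟨y, hy, hxy⟩ := exists_normalized_eq (u := u) a hr t x
    have h1 := hmedium (ε / r) (by rw [lt_div_iff₀ hr]; linarith) (by rwa [div_le_iff₀ hr])
      (normalized u a r t) (measurable_normalized hu a r t) (bounded_normalized hb a r t)
      (normalized_nonneg h0 a r ht0.le)
      (fun z hz => superAt_normalized hr hr1 ht hρ.le ha hN hsup hz) y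
      (fun i => ?_) (by rw [hy, div_le_iff₀ ht0, one_mul]; exact hux) K hK0
    · rw [volume_superlevel_inter_hcube a hr ht0, volume_hcube a hr.le, mul_comm]
      gcongr
    · have h2 := hx i
      rw [hxy i] at h2
      constructor <;> nlinarith
  have hQ : ∀ i : Fin N, -1 / 2 ≤ (fun _ : Fin N => (-1 / 2 : ℝ)) i ∧
      (fun _ : Fin N => (-1 / 2 : ℝ)) i + 1 ≤ 1 / 2 := fun i => by norm_num
  have hQv : volume (hcube (fun _ : Fin N => (-1 / 2 : ℝ)) 1) = 1 := by
    rw [volume_hcube _ zero_le_one, one_pow, ENNReal.ofReal_one]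
  obtain ⟨x, hx, hux⟩ : ∃ x ∈ cube (fun _ : Fin N => (0 : ℝ)) 3, u x ≤ 3 / 2 := by
    obtain ⟨_, ⟨x, hx, rfl⟩, h⟩ := exists_lt_of_csInf_lt
      (Set.Nonempty.image u ⟨0, fun i => by norm_num⟩)
      (lt_of_le_of_lt hinf (by norm_num : (1 : ℝ) < 3 / 2))
    exact ⟨x, hx, h.le⟩
  have hone : volume ({x | K < u x} ∩ hcube (fun _ : Fin N => (-1 / 2 : ℝ)) 1) ≤
      ENNReal.ofReal μ := by
    have h1 := hbasic 1 le_rfl (fun _ => -1 / 2) 1 one_pos hQ (by rwa [mul_one]) x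
      (fun i => by
        have := (hx i).le
        norm_num at this ⊢
        exact this) (by rwa [mul_one])
    rwa [hQv, mul_one, mul_one] at h1
  obtain ⟨L, hL1, hL2⟩ : ∃ L : ℕ, ε * 2 ^ L ≤ ε₀ * 1 ∧ ε₀ * 1 < ε * 2 ^ (L + 1) := by
    obtain ⟨L, h1, h2⟩ := exists_nat_pow_near ((one_le_div hε).2 hεε) one_lt_two
    rw [le_div_iff₀ hε] at h1
    rw [div_lt_iff₀ hε] at h2
    exact ⟨L, by linarith, by linarith⟩
  have hiter : ∀ k : ℕ, 1 ≤ k →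
      volume ({x | K ^ k < u x} ∩ hcube (fun _ : Fin N => (-1 / 2 : ℝ)) 1) ≤
        ENNReal.ofReal (c / ((1 - μ) * K) + μ ^ k) := by
    intro k hk
    induction k, hk using Nat.le_induction with
    | base =>
      rw [pow_one, pow_one]
      refine hone.trans (ENNReal.ofReal_le_ofReal ?_)
      have : 0 ≤ c / ((1 - μ) * K) := by positivity
      linarith
    | succ k hk ih =>
      have ht : 1 ≤ K ^ k := one_le_pow₀ hK1
      have h1 := volume_inter_hcube_le_of_dyadic (ε₀ := ε₀) (t := K ^ k) hε hu
        (measurableSet_lt (measurable_const (a := K * K ^ k)) hu)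
        (fun a r hr ha hεr x hx hux =>
          hbasic (K ^ k) ht a r hr ha hεr x hx (by linarith))
        (hmed (K ^ k) ht) L one_pos hQ hL1 hL2 ?_
      · rw [pow_succ' K]
        refine h1.trans ?_
        rw [hQv, mul_one]
        refine (add_le_add_left (mul_le_mul_right ih _) _).trans (le_of_eq ?_)
        have hμ0 := hμ.1
        rw [← ENNReal.ofReal_mul hμ0.le, ← ENNReal.ofReal_add (by positivity) (by positivity)]
        congr 1
        field_simp
        ring
      · rw [hQv, mul_one]
        refine le_trans (measure_mono ?_) hone
        refine Set.inter_subset_inter_left _ fun z hz => lt_of_le_of_lt (b := K * K ^ k) ?_ hz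
        exact le_mul_of_one_le_right hK0.le ht
  intro k hk
  refine le_trans (measure_mono ?_) (hiter k hk)
  refine Set.inter_subset_inter_right _ fun z hz i => ?_
  have h1 := abs_lt.1 (hz i)
  rw [sub_zero] at h1
  constructor <;> linarith [h1.1, h1.2]
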